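/- (Isotropic Sobolev product law) Let d ≥ 1 be an integer and s, t < d/2 real numbers with s + t > 0. Then there exists a constant C > 0 such that for all Schwartz functions u and v on ℝ^d, ‖uv‖_{H^{s+t−d/2}(ℝ^d)} ≤ C ‖u‖_{H^s(ℝ^d)} ‖v‖_{H^t(ℝ^d)}. -/

import Mathlib

/- Isotropic Sobolev product law: for s, t < d/2 with s + t > 0,
`‖uv‖_{H^{s+t-d/2}} ≤ C ‖u‖_{H^s} ‖v‖_{H^t}`. -/

open MeasureTheory Real
open scoped FourierTransform ENNReal
noncomputable section

/-- the (inhomogeneous) Sobolev norm `H^s(ℝ^d)`, defined through the Fourier transform. -/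
def sobNorm {d : ℕ} (s : ℝ) (f : EuclideanSpace ℝ (Fin d) → ℂ) : ℝ :=
  (∫ ξ : EuclideanSpace ℝ (Fin d), (1 + ‖ξ‖^2) ^ s * ‖𝓕 f ξ‖^2) ^ (1/2 : ℝ)

namespace SobolevProduct

variable {E : Type*} [NormedAddCommGroup E]

/-- The weight `(1 + ‖x‖²) ^ r` with values in `ℝ≥0∞`. -/
def weight (r : ℝ) (x : E) : ℝ≥0∞ := ENNReal.ofReal ((1 + ‖x‖ ^ 2) ^ r)

lemma weight_mul_weight (r s : ℝ) (x : E) : weight r x * weight s x = weight (r + s) x := by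
  rw [weight, weight, weight, ← ENNReal.ofReal_mul (by positivity), ← rpow_add (by positivity)]

@[simp]
lemma weight_zero (x : E) : weight 0 x = 1 := by simp [weight]

lemma weight_sq (r : ℝ) (x : E) : weight r x ^ 2 = weight (2 * r) x := by
  rw [sq, weight_mul_weight, two_mul]

lemma weight_le_of_norm_le {x y : E} (hxy : ‖x‖ ≤ 2 * ‖y‖) (hyx : ‖y‖ ≤ 2 * ‖x‖) (r : ℝ) :
    weight r x ≤ ENNReal.ofReal (4 ^ |r|) * weight r y := by
  rw [weight, weight, ← ENNReal.ofReal_mul (by positivity)]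
  apply ENNReal.ofReal_le_ofReal
  have hx : (1 + ‖x‖ ^ 2) ≤ 4 * (1 + ‖y‖ ^ 2) := by nlinarith [norm_nonneg x]
  have hy : (1 + ‖y‖ ^ 2) ≤ 4 * (1 + ‖x‖ ^ 2) := by nlinarith [norm_nonneg y]
  rcases le_total 0 r with hr | hr
  · rw [abs_of_nonneg hr, ← mul_rpow (by norm_num) (by positivity)]
    exact rpow_le_rpow (by positivity) hx hr
  · rw [abs_of_nonpos hr, rpow_neg (by norm_num), ← inv_rpow (by norm_num),
      ← mul_rpow (by norm_num) (by positivity)]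
    exact rpow_le_rpow_of_nonpos (by positivity) (by linarith) hr

section Kernel

variable [InnerProductSpace ℝ E]

/-- The kernel dominating the product weight where `x` is the smallest of three frequencies
with sum zero and `y` is one of the other two. -/
def kernel (δ : ℝ) (x y : E) : ℝ≥0∞ :=
  (Metric.ball (0 : E) (√(1 + ‖y‖ ^ 2))).indicator (weight δ) x *
    weight (-(Module.finrank ℝ E / 4) - δ) y

lemma kernel_of_norm_le {x y : E} (h : ‖x‖ ≤ ‖y‖) (δ : ℝ) :
    kernel δ x y = weight δ x * weight (-(Module.finrank ℝ E / 4) - δ) y := by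
  rw [kernel, Set.indicator_of_mem]
  rw [mem_ball_zero_iff]
  apply lt_sqrt_of_sq_lt
  nlinarith [norm_nonneg x]

lemma exists_weight_mul_le_kernel {α β γ : ℝ} (h : α + β + γ = -(Module.finrank ℝ E / 4)) :
    ∃ C : ℝ, 0 ≤ C ∧ ∀ x y : E, weight α x * weight β y * weight γ (x + y) ≤
      ENNReal.ofReal C * (kernel α x y + kernel β y x + kernel γ (x + y) y) := by
  have aux : ∀ (α β γ : ℝ), α + β + γ = -(Module.finrank ℝ E / 4) → ∀ x y z : E, ‖x‖ ≤ ‖y‖ →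
      ‖z‖ ≤ 2 * ‖y‖ → ‖y‖ ≤ 2 * ‖z‖ → weight α x * weight β y * weight γ z ≤
        ENNReal.ofReal (4 ^ |γ|) * kernel α x y := by
    intro α β γ h x y z hxy hzy hyz
    calc weight α x * weight β y * weight γ z
        ≤ weight α x * weight β y * (ENNReal.ofReal (4 ^ |γ|) * weight γ y) := by
          gcongr
          exact weight_le_of_norm_le hzy hyz γ
      _ = ENNReal.ofReal (4 ^ |γ|) * (weight α x * (weight β y * weight γ y)) := by ring
      _ = _ := by
          rw [weight_mul_weight, kernel_of_norm_le hxy, ← h]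
          ring_nf
  refine ⟨4 ^ |γ| + 4 ^ |γ| + 4 ^ |α|, by positivity, fun x y ↦ ?_⟩
  have hz : ‖x + y‖ ≤ ‖x‖ + ‖y‖ := norm_add_le x y
  have hx : ‖x‖ ≤ ‖x + y‖ + ‖y‖ := by simpa using norm_sub_le (x + y) y
  have hy : ‖y‖ ≤ ‖x + y‖ + ‖x‖ := by simpa using norm_sub_le (x + y) x
  by_cases h1 : ‖x‖ ≤ ‖y‖ ∧ ‖x‖ ≤ ‖x + y‖
  · refine (aux α β γ h x y (x + y) h1.1 (by linarith) (by linarith)).trans ?_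
    gcongr
    · exact le_add_of_le_of_nonneg (le_add_of_nonneg_left (by positivity)) (by positivity)
    · exact (le_self_add).trans le_self_add
  by_cases h2 : ‖y‖ ≤ ‖x‖ ∧ ‖y‖ ≤ ‖x + y‖
  · rw [mul_comm (weight α x)]
    refine (aux β α γ (by linarith) y x (x + y) h2.1 (by linarith) (by linarith)).trans ?_
    gcongr
    · exact le_add_of_le_of_nonneg (le_add_of_nonneg_left (by positivity)) (by positivity)
    · exact le_add_self.trans le_self_add
  have h3 : ‖x + y‖ ≤ ‖y‖ ∧ ‖x + y‖ ≤ ‖x‖ := by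
    rcases le_total ‖x‖ ‖y‖ with hxy | hxy <;> grind
  rw [show weight α x * weight β y * weight γ (x + y) =
    weight γ (x + y) * weight β y * weight α x by ring]
  refine (aux γ β α (by linarith) (x + y) y x h3.1 (by linarith) (by linarith)).trans ?_
  gcongr
  · exact le_add_of_nonneg_left (by positivity)
  · exact le_add_self

end Kernel

section Measure

variable [MeasurableSpace E] [BorelSpace E]

@[fun_prop]
lemma measurable_weight (r : ℝ) : Measurable (weight r : E → ℝ≥0∞) := by
  unfold weight
  fun_prop

lemma lintegral_mul_le_rpow_mul_rpow {α : Type*} [MeasurableSpace α] (μ : Measure α) {f g : α → ℝ≥0∞}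
    (hf : AEMeasurable f μ) (hg : AEMeasurable g μ) :
    ∫⁻ x, f x * g x ∂μ ≤ (∫⁻ x, f x ^ 2 ∂μ) ^ (1 / 2 : ℝ) * (∫⁻ x, g x ^ 2 ∂μ) ^ (1 / 2 : ℝ) := by
  simpa using ENNReal.lintegral_mul_le_Lp_mul_Lq μ HolderConjugate.two_two hf hg

variable [InnerProductSpace ℝ E]

@[fun_prop]
lemma measurable_kernel [SecondCountableTopology E] {α : Type*} [MeasurableSpace α] {f g : α → E}
    (hf : Measurable f) (hg : Measurable g) (δ : ℝ) :
    Measurable fun a ↦ kernel δ (f a) (g a) := by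
  refine Measurable.mul ?_ (by fun_prop)
  have hS : MeasurableSet {a | ‖f a‖ < √(1 + ‖g a‖ ^ 2)} :=
    measurableSet_lt (by fun_prop) (by fun_prop)
  convert! ((measurable_weight (E := E) δ).comp hf).indicator hS using 1
  ext a
  simp [Set.indicator]

variable [FiniteDimensional ℝ E]

lemma setIntegral_ball_norm_rpow [Nontrivial E] {r R : ℝ} (hr : -(Module.finrank ℝ E : ℝ) < r)
    (hR : 0 < R) :
    ∫ x in Metric.ball (0 : E) R, ‖x‖ ^ r =
      Module.finrank ℝ E * volume.real (Metric.ball (0 : E) 1) *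
        (R ^ (r + Module.finrank ℝ E) / (r + Module.finrank ℝ E)) := by
  have h := integral_fun_norm_addHaar (volume : Measure E)
    (fun y ↦ (Set.Iio R).indicator (fun y : ℝ ↦ y ^ r) y)
  have hball : ∀ x : E, (Set.Iio R).indicator (fun y : ℝ ↦ y ^ r) ‖x‖ =
      (Metric.ball (0 : E) R).indicator (fun x ↦ ‖x‖ ^ r) x := fun x ↦ by
    simp [Set.indicator]
  simp_rw [hball] at h
  rw [integral_indicator Metric.isOpen_ball.measurableSet] at h
  rw [h, nsmul_eq_mul, smul_eq_mul, ← mul_assoc]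
  congr 1
  have hdim : 1 ≤ Module.finrank ℝ E := Module.finrank_pos
  calc ∫ y in Set.Ioi (0 : ℝ), y ^ (Module.finrank ℝ E - 1) •
          (Set.Iio R).indicator (fun y : ℝ ↦ y ^ r) y
      = ∫ y in Set.Ioi (0 : ℝ),
          (Set.Iio R).indicator (fun y : ℝ ↦ y ^ (r + Module.finrank ℝ E - 1)) y := by
        refine setIntegral_congr_fun measurableSet_Ioi fun y hy ↦ ?_
        by_cases hyR : y < R
        · simp only [Set.indicator, Set.mem_Iio, hyR, if_true, smul_eq_mul]
          rw [← rpow_natCast, ← rpow_add hy]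
          push_cast [hdim]
          ring_nf
        · simp [Set.indicator, hyR]
    _ = ∫ y in (0 : ℝ)..R, y ^ (r + Module.finrank ℝ E - 1) := by
        rw [setIntegral_indicator measurableSet_Iio, Set.Ioi_inter_Iio,
          intervalIntegral.integral_of_le hR.le, integral_Ioc_eq_integral_Ioo]
    _ = _ := by
        rw [integral_rpow (Or.inl (by linarith)), sub_add_cancel, zero_rpow (by linarith), sub_zero]

lemma exists_lintegral_ball_weight_le [Nontrivial E] {q : ℝ} (hq : 0 < q) :
    ∃ C : ℝ, 0 ≤ C ∧ ∀ R : ℝ, 1 ≤ R →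
      ∫⁻ x in Metric.ball (0 : E) R, weight (q - Module.finrank ℝ E / 2) x ≤
        ENNReal.ofReal (C * R ^ (2 * q)) := by
  set n : ℝ := ((Module.finrank ℝ E : ℕ) : ℝ) with hn
  have hdim : 1 ≤ Module.finrank ℝ E := Module.finrank_pos
  have hn1 : 1 ≤ n := Nat.one_le_cast.mpr hdim
  set p := min q (n / 4)
  have hp : 0 < p := lt_min hq (by linarith)
  have hpq : p ≤ q := min_le_left _ _
  have hpn : p ≤ n / 4 := min_le_right _ _
  set A : ℝ := n * volume.real (Metric.ball (0 : E) 1) / (2 * p)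
  refine ⟨2 ^ (q - p) * A, by positivity, fun R hR ↦ ?_⟩
  have hint : IntegrableOn (fun x : E ↦ ‖x‖ ^ (2 * p - n)) (Metric.ball 0 R) := by
    refine integrableOn_ball_of_norm_le_rpow (α := n - 2 * p) (C := 1) hdim (by linarith) ?_ ?_
    · refine ae_of_all _ fun x ↦ ?_
      rw [norm_of_nonneg (by positivity), one_mul, neg_sub]
    · exact (measurable_norm.pow_const _).aestronglyMeasurable
  have hpt : ∀ᵐ x : E ∂volume.restrict (Metric.ball 0 R), weight (q - n / 2) x ≤
      ENNReal.ofReal ((2 * R ^ 2) ^ (q - p)) * ENNReal.ofReal (‖x‖ ^ (2 * p - n)) := by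
    filter_upwards [ae_restrict_mem Metric.isOpen_ball.measurableSet,
      ae_restrict_of_ae (Measure.ae_ne volume (0 : E))] with x hx hx0
    rw [← ENNReal.ofReal_mul (by positivity)]
    apply ENNReal.ofReal_le_ofReal
    have hx0' : 0 < ‖x‖ := norm_pos_iff.mpr hx0
    have hxR : ‖x‖ < R := by simpa using hx
    rw [show q - n / 2 = (q - p) + (p - n / 2) by ring, rpow_add (by positivity)]
    gcongr ?_ * ?_
    · exact rpow_le_rpow (by positivity) (by nlinarith) (by linarith)
    · rw [show 2 * p - n = (2 : ℕ) * (p - n / 2) by push_cast; ring, rpow_natCast_mul hx0'.le]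
      exact rpow_le_rpow_of_nonpos (by positivity) (by linarith) (by linarith)
  calc ∫⁻ x in Metric.ball (0 : E) R, weight (q - n / 2) x
      ≤ ∫⁻ x in Metric.ball (0 : E) R,
          ENNReal.ofReal ((2 * R ^ 2) ^ (q - p)) * ENNReal.ofReal (‖x‖ ^ (2 * p - n)) :=
        lintegral_mono_ae hpt
    _ = ENNReal.ofReal ((2 * R ^ 2) ^ (q - p) * (A * R ^ (2 * p))) := by
        rw [lintegral_const_mul' _ _ ENNReal.ofReal_ne_top,
          ← ofReal_integral_eq_lintegral_ofReal hint (ae_of_all _ fun x ↦ by positivity),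
          setIntegral_ball_norm_rpow (by linarith) (by linarith),
          ← ENNReal.ofReal_mul (by positivity), ← hn, sub_add_cancel]
        congr 2
        ring
    _ = ENNReal.ofReal (2 ^ (q - p) * A * R ^ (2 * q)) := by
        rw [mul_rpow (by norm_num) (by positivity), ← rpow_natCast_mul (by linarith),
          show 2 * q = (2 : ℕ) * (q - p) + 2 * p by push_cast; ring, rpow_add (by linarith)]
        congr 1
        ring


lemma exists_lintegral_kernel_sq_le [Nontrivial E] {δ : ℝ}
    (hδ : -(Module.finrank ℝ E / 4 : ℝ) < δ) :
    ∃ M : ℝ, 0 ≤ M ∧ ∀ y : E, ∫⁻ x, kernel δ x y ^ 2 ≤ ENNReal.ofReal M := by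
  obtain ⟨C, hC, hball⟩ := exists_lintegral_ball_weight_le (E := E)
    (q := Module.finrank ℝ E / 2 + 2 * δ) (by linarith)
  refine ⟨C, hC, fun y ↦ ?_⟩
  set R := √(1 + ‖y‖ ^ 2) with hR
  have hR1 : 1 ≤ R := one_le_sqrt.mpr (by nlinarith [norm_nonneg y])
  have hsq : ∀ x, kernel δ x y ^ 2 = (Metric.ball (0 : E) R).indicator (weight (2 * δ)) x *
      weight (-(Module.finrank ℝ E / 2 + 2 * δ)) y := fun x ↦ by
    rw [kernel, mul_pow, weight_sq]
    congr 1
    · by_cases hx : x ∈ Metric.ball (0 : E) R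
      · rw [Set.indicator_of_mem hx, Set.indicator_of_mem hx, weight_sq]
      · rw [Set.indicator_of_notMem hx, Set.indicator_of_notMem hx, zero_pow two_ne_zero]
    · ring_nf
  simp_rw [hsq]
  rw [lintegral_mul_const _ ((measurable_weight _).indicator Metric.isOpen_ball.measurableSet),
    lintegral_indicator Metric.isOpen_ball.measurableSet]
  have hb := hball R hR1
  rw [add_sub_cancel_left] at hb
  refine (mul_le_mul_left hb _).trans_eq ?_
  rw [weight, ← ENNReal.ofReal_mul (by positivity), show 2 * (Module.finrank ℝ E / 2 + 2 * δ) =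
    (2 : ℕ) * (Module.finrank ℝ E / 2 + 2 * δ) by push_cast; ring,
    rpow_natCast_mul (by positivity), hR, sq_sqrt (by positivity), mul_assoc,
    ← rpow_add (by positivity), add_neg_cancel, rpow_zero, mul_one]

/-- The `L²` seminorm of an `ℝ≥0∞`-valued function. -/
def lTwo (F : E → ℝ≥0∞) : ℝ≥0∞ := (∫⁻ x, F x ^ 2) ^ (1 / 2 : ℝ)

lemma lintegral_trilinear_kernel_le {K : E → E → ℝ≥0∞} {M : ℝ≥0∞}
    (hK : Measurable fun p : E × E ↦ K p.1 p.2) (hM : ∀ y, ∫⁻ x, K x y ^ 2 ≤ M)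
    {F G H : E → ℝ≥0∞} (hF : Measurable F) (hG : Measurable G) (hH : Measurable H) :
    ∫⁻ p : E × E, F p.1 * G p.2 * H (p.1 + p.2) * K p.1 p.2 ∂(volume.prod volume) ≤
      M ^ (1 / 2 : ℝ) * (lTwo F * lTwo G * lTwo H) := by
  have h1 : ∫⁻ p : E × E, (F p.1 * H (p.1 + p.2)) ^ 2 ∂(volume.prod volume) =
      (∫⁻ x, F x ^ 2) * ∫⁻ x, H x ^ 2 := by
    rw [lintegral_prod _ (by fun_prop)]
    simp_rw [mul_pow]
    rw [← lintegral_mul_const _ (by fun_prop)]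
    refine lintegral_congr fun x ↦ ?_
    rw [lintegral_const_mul _ (by fun_prop), lintegral_add_left_eq_self (fun z ↦ H z ^ 2)]
  have h2 : ∫⁻ p : E × E, (G p.2 * K p.1 p.2) ^ 2 ∂(volume.prod volume) ≤
      (∫⁻ x, G x ^ 2) * M := by
    rw [lintegral_prod_symm' _ (by fun_prop)]
    simp_rw [mul_pow]
    rw [← lintegral_mul_const _ (by fun_prop)]
    refine lintegral_mono fun y ↦ ?_
    have hKy : Measurable fun x ↦ K x y := hK.comp measurable_prodMk_right
    rw [lintegral_const_mul _ (hKy.pow_const 2)]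
    exact mul_le_mul_right (hM y) _
  calc ∫⁻ p : E × E, F p.1 * G p.2 * H (p.1 + p.2) * K p.1 p.2 ∂(volume.prod volume)
      = ∫⁻ p : E × E, (F p.1 * H (p.1 + p.2)) * (G p.2 * K p.1 p.2) ∂(volume.prod volume) := by
        refine lintegral_congr fun p ↦ ?_
        ring
    _ ≤ ((∫⁻ x, F x ^ 2) * ∫⁻ x, H x ^ 2) ^ (1 / 2 : ℝ) *
          ((∫⁻ x, G x ^ 2) * M) ^ (1 / 2 : ℝ) := by
        refine (lintegral_mul_le_rpow_mul_rpow _ (by fun_prop) (by fun_prop)).trans ?_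
        rw [h1]
        gcongr
    _ = _ := by
        rw [ENNReal.mul_rpow_of_nonneg _ _ (by norm_num),
          ENNReal.mul_rpow_of_nonneg _ _ (by norm_num), lTwo, lTwo, lTwo]
        ring

/-- The trilinear estimate dual to the product law. -/
lemma exists_lintegral_trilinear_weight_le [Nontrivial E] {α β γ : ℝ}
    (h : α + β + γ = -(Module.finrank ℝ E / 4)) (hα : -(Module.finrank ℝ E / 4 : ℝ) < α)
    (hβ : -(Module.finrank ℝ E / 4 : ℝ) < β) (hγ : -(Module.finrank ℝ E / 4 : ℝ) < γ) :
    ∃ C : ℝ≥0∞, C ≠ ⊤ ∧ ∀ F G H : E → ℝ≥0∞, Measurable F → Measurable G → Measurable H →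
      ∫⁻ p : E × E, F p.1 * G p.2 * H (p.1 + p.2) *
          (weight α p.1 * weight β p.2 * weight γ (p.1 + p.2)) ∂(volume.prod volume) ≤
        C * (lTwo F * lTwo G * lTwo H) := by
  obtain ⟨C, -, hker⟩ := exists_weight_mul_le_kernel (E := E) h
  obtain ⟨A, -, hA⟩ := exists_lintegral_kernel_sq_le (E := E) hα
  obtain ⟨B, -, hB⟩ := exists_lintegral_kernel_sq_le (E := E) hβ
  obtain ⟨D, -, hD⟩ := exists_lintegral_kernel_sq_le (E := E) hγ
  refine ⟨ENNReal.ofReal C * (ENNReal.ofReal A ^ (1 / 2 : ℝ) + ENNReal.ofReal B ^ (1 / 2 : ℝ) +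
    ENNReal.ofReal D ^ (1 / 2 : ℝ)), by finiteness, fun F G H hF hG hH ↦ ?_⟩
  have e1 := lintegral_trilinear_kernel_le (K := kernel α) (by fun_prop) hA hF hG hH
  have e2 := lintegral_trilinear_kernel_le (K := kernel β) (by fun_prop) hB hG hF hH
  have e3 := lintegral_trilinear_kernel_le (K := fun x y ↦ kernel γ (x + y) y) (by fun_prop)
    (fun y ↦ (lintegral_add_right_eq_self (fun z ↦ kernel γ z y ^ 2) y).trans_le (hD y)) hF hG hH
  rw [← lintegral_prod_swap] at e2
  simp only [Prod.fst_swap, Prod.snd_swap] at e2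
  calc _ ≤ ∫⁻ p : E × E, ENNReal.ofReal C * (F p.1 * G p.2 * H (p.1 + p.2) * kernel α p.1 p.2 +
          G p.2 * F p.1 * H (p.2 + p.1) * kernel β p.2 p.1 +
          F p.1 * G p.2 * H (p.1 + p.2) * kernel γ (p.1 + p.2) p.2) ∂(volume.prod volume) := by
        refine lintegral_mono fun p ↦ ?_
        refine (mul_le_mul_right (hker p.1 p.2) _).trans_eq ?_
        rw [add_comm p.2 p.1]
        ring
    _ ≤ _ := by
        rw [lintegral_const_mul' _ _ ENNReal.ofReal_ne_top, lintegral_add_left (by fun_prop),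
          lintegral_add_left (by fun_prop), mul_assoc]
        refine mul_le_mul_right ((add_le_add (add_le_add e1 e2) e3).trans_eq ?_) _
        ring

/-- The product law in frequency space: `W` is dominated by the convolution of `U` and `V`. -/
lemma exists_lTwo_mul_weight_le_of_le_convolution [Nontrivial E] {s t : ℝ}
    (hs : s < Module.finrank ℝ E / 2) (ht : t < Module.finrank ℝ E / 2) (hst : 0 < s + t) :
    ∃ C : ℝ≥0∞, C ≠ ⊤ ∧ ∀ U V W : E → ℝ≥0∞, Measurable U → Measurable V → Measurable W →
      (∀ z, W z ≤ ∫⁻ x, U x * V (z - x)) →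
      lTwo (fun x ↦ W x * weight ((s + t - Module.finrank ℝ E / 2) / 2) x) ≠ ⊤ →
      lTwo (fun x ↦ W x * weight ((s + t - Module.finrank ℝ E / 2) / 2) x) ≤
        C * (lTwo (fun x ↦ U x * weight (s / 2) x) * lTwo (fun x ↦ V x * weight (t / 2) x)) := by
  set γ := (s + t - Module.finrank ℝ E / 2) / 2 with hγ
  obtain ⟨C, hC, htri⟩ := exists_lintegral_trilinear_weight_le (E := E)
    (α := -(s / 2)) (β := -(t / 2)) (γ := γ) (by rw [hγ]; ring) (by linarith) (by linarith)
    (by rw [hγ]; linarith)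
  refine ⟨C, hC, fun U V W hU hV hW hconv hfin ↦ ?_⟩
  have hH : Measurable fun x ↦ W x * weight γ x := by fun_prop
  have hH2 (z : E) : (W z * weight γ z) ^ 2 = W z * (W z * weight γ z * weight γ z) := by ring
  set H := fun x ↦ W x * weight γ x
  set F := fun x ↦ U x * weight (s / 2) x with hF
  set G := fun x ↦ V x * weight (t / 2) x with hG
  have hFx (x : E) : F x * weight (-(s / 2)) x = U x := by
    rw [hF, mul_assoc, weight_mul_weight, add_neg_cancel, weight_zero, mul_one]
  have hGx (x : E) : G x * weight (-(t / 2)) x = V x := by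
    rw [hG, mul_assoc, weight_mul_weight, add_neg_cancel, weight_zero, mul_one]
  have hpt (p : E × E) : F p.1 * G p.2 * H (p.1 + p.2) * (weight (-(s / 2)) p.1 *
      weight (-(t / 2)) p.2 * weight γ (p.1 + p.2)) =
      U p.1 * V p.2 * (H (p.1 + p.2) * weight γ (p.1 + p.2)) := by
    rw [← hFx, ← hGx]
    ring
  have hT := htri F G H (by fun_prop) (by fun_prop) hH
  rw [lintegral_congr hpt, lintegral_prod _ (by fun_prop)] at hT
  have hsq : lTwo H * lTwo H ≤ C * (lTwo F * lTwo G) * lTwo H := by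
    calc lTwo H * lTwo H = ∫⁻ z, H z ^ 2 := by
          rw [lTwo, ← ENNReal.rpow_add_of_nonneg _ _ (by norm_num) (by norm_num)]
          norm_num
      _ ≤ ∫⁻ z, ∫⁻ x, U x * V (z - x) * (H z * weight γ z) := by
          refine lintegral_mono fun z ↦ ?_
          rw [lintegral_mul_const _ (by fun_prop), hH2]
          exact mul_le_mul_left (hconv z) _
      _ = ∫⁻ x, ∫⁻ y, U x * V y * (H (x + y) * weight γ (x + y)) := by
          rw [lintegral_lintegral_swap (by unfold Function.uncurry; fun_prop)]
          refine lintegral_congr fun x ↦ ?_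
          rw [← lintegral_add_left_eq_self _ x]
          simp only [add_sub_cancel_left]
      _ ≤ C * (lTwo F * lTwo G * lTwo H) := hT
      _ = _ := by ring
  rcases eq_or_ne (lTwo H) 0 with h0 | h0
  · rw [h0]
    exact zero_le
  · exact (ENNReal.mul_le_mul_iff_left h0 hfin).mp hsq

lemma enorm_fourier_mul_le (u v : SchwartzMap E ℂ) (z : E) :
    ‖𝓕 (fun x ↦ u x * v x) z‖ₑ ≤ ∫⁻ x, ‖𝓕 (u : E → ℂ) x‖ₑ * ‖𝓕 (v : E → ℂ) (z - x)‖ₑ := by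
  have h := SchwartzMap.convolution_apply (ContinuousLinearMap.mul ℂ ℂ) (𝓕⁻ u) (𝓕⁻ v) (-z)
  have h' : SchwartzMap.convolution (ContinuousLinearMap.mul ℂ ℂ) (𝓕⁻ u) (𝓕⁻ v) (-z) =
      𝓕 (fun x ↦ u x * v x) z := by
    calc _ = 𝓕⁻ (SchwartzMap.pairing (ContinuousLinearMap.mul ℂ ℂ) (𝓕 (𝓕⁻ u)) (𝓕 (𝓕⁻ v))) (-z) :=
          rfl
      _ = _ := by
          rw [FourierTransform.fourier_fourierInv_eq, FourierTransform.fourier_fourierInv_eq,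
            SchwartzMap.fourierInv_coe, fourierInv_eq_fourier_neg, neg_neg]
          rfl
  rw [← h', h, MeasureTheory.convolution]
  refine (enorm_integral_le_lintegral_enorm _).trans_eq ?_
  rw [← lintegral_neg_eq_self]
  refine lintegral_congr fun x ↦ ?_
  rw [ContinuousLinearMap.mul_apply', enorm_mul, SchwartzMap.fourierInv_coe,
    SchwartzMap.fourierInv_coe, fourierInv_eq_fourier_neg, fourierInv_eq_fourier_neg, neg_neg,
    show -(-z - -x) = z - x by abel]

lemma measurable_enorm_fourier (u : SchwartzMap E ℂ) :
    Measurable fun x ↦ ‖𝓕 (u : E → ℂ) x‖ₑ := by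
  rw [← SchwartzMap.fourier_coe]
  exact (𝓕 u).continuous.measurable.enorm

/-- The weighted Fourier transform, whose `L²` norm is the Sobolev norm. -/
def weightedFourier (s : ℝ) (f : E → ℂ) (x : E) : ℝ≥0∞ := ‖𝓕 f x‖ₑ * weight (s / 2) x

lemma weightedFourier_sq (s : ℝ) (f : E → ℂ) (x : E) :
    weightedFourier s f x ^ 2 = ENNReal.ofReal ((1 + ‖x‖ ^ 2) ^ s * ‖𝓕 f x‖ ^ 2) := by
  rw [weightedFourier, mul_pow, weight_sq, mul_div_cancel₀ _ two_ne_zero, weight,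
    ENNReal.ofReal_mul (by positivity), ENNReal.ofReal_pow (norm_nonneg _), ofReal_norm,
    mul_comm]

lemma integrable_weight_mul_fourier_sq (s : ℝ) (u : SchwartzMap E ℂ) :
    Integrable fun x : E ↦ (1 + ‖x‖ ^ 2) ^ s * ‖𝓕 (u : E → ℂ) x‖ ^ 2 := by
  have hg : (fun x : E ↦ (1 + ‖x‖ ^ 2) ^ (s / 2)).HasTemperateGrowth := by fun_prop
  have h := ((SchwartzMap.smulLeftCLM ℂ (fun x : E ↦ (1 + ‖x‖ ^ 2) ^ (s / 2)) (𝓕 u)).memLp 2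
    volume).integrable_norm_pow two_ne_zero
  refine h.congr (ae_of_all _ fun x ↦ ?_)
  simp only [SchwartzMap.smulLeftCLM_apply_apply hg, norm_smul, mul_pow, SchwartzMap.fourier_coe]
  rw [norm_of_nonneg (by positivity), ← rpow_mul_natCast (by positivity)]
  push_cast
  rw [div_mul_cancel₀ _ two_ne_zero]

lemma lTwo_weightedFourier_ne_top (s : ℝ) (u : SchwartzMap E ℂ) :
    lTwo (weightedFourier s (u : E → ℂ)) ≠ ⊤ := by
  simp_rw [lTwo, weightedFourier_sq]
  exact ENNReal.rpow_ne_top_of_nonneg (by norm_num)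
    (integrable_weight_mul_fourier_sq s u).lintegral_lt_top.ne

end Measure

lemma sobNorm_eq_toReal_lTwo {d : ℕ} (s : ℝ) (u : SchwartzMap (EuclideanSpace ℝ (Fin d)) ℂ) :
    sobNorm s (u : EuclideanSpace ℝ (Fin d) → ℂ) = (lTwo (weightedFourier s u)).toReal := by
  rw [sobNorm, integral_eq_lintegral_of_nonneg_ae (ae_of_all _ fun x ↦ by positivity)
    (integrable_weight_mul_fourier_sq s u).aestronglyMeasurable, lTwo, ENNReal.toReal_rpow]
  simp_rw [weightedFourier_sq]

end SobolevProduct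

open SobolevProduct

theorem isotropic_sobolev_product_law (d : ℕ) (hd : 1 ≤ d) (s t : ℝ)
    (hs : s < d / 2) (ht : t < d / 2) (hst : 0 < s + t) :
    ∃ C > (0:ℝ), ∀ u v : SchwartzMap (EuclideanSpace ℝ (Fin d)) ℂ,
      sobNorm (s + t - d / 2) (fun x => u x * v x) ≤
        C * sobNorm s (u : EuclideanSpace ℝ (Fin d) → ℂ) *
          sobNorm t (v : EuclideanSpace ℝ (Fin d) → ℂ) := by
  have : Nontrivial (EuclideanSpace ℝ (Fin d)) :=
    Module.nontrivial_of_finrank_pos (R := ℝ) (by rw [finrank_euclideanSpace_fin]; omega)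
  obtain ⟨C, hC, h⟩ := exists_lTwo_mul_weight_le_of_le_convolution
    (E := EuclideanSpace ℝ (Fin d)) (s := s) (t := t) (by simpa using hs) (by simpa using ht) hst
  refine ⟨C.toReal + 1, by positivity, fun u v ↦ ?_⟩
  set w := SchwartzMap.pairing (ContinuousLinearMap.mul ℂ ℂ) u v
  have hw : (fun x ↦ u x * v x) = (w : EuclideanSpace ℝ (Fin d) → ℂ) := rfl
  rw [finrank_euclideanSpace_fin] at h
  have huv := h _ _ _ (measurable_enorm_fourier u) (measurable_enorm_fourier v)
    (measurable_enorm_fourier w) (enorm_fourier_mul_le u v) (lTwo_weightedFourier_ne_top _ w)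
  rw [hw, sobNorm_eq_toReal_lTwo, sobNorm_eq_toReal_lTwo, sobNorm_eq_toReal_lTwo, mul_assoc,
    ← ENNReal.toReal_mul]
  have hfin := ENNReal.mul_ne_top (lTwo_weightedFourier_ne_top s u) (lTwo_weightedFourier_ne_top t v)
  refine (ENNReal.toReal_mono (ENNReal.mul_ne_top hC hfin) huv).trans ?_
  rw [ENNReal.toReal_mul]
  gcongr
  linarith
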